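/- Let p ≠ 3 be prime and let φ : V(𝔽_p) → ℂ be a GL₂(𝔽_p)-invariant function with |φ(f)| ≤ 1 for all f ∈ V(𝔽_p). Then its Fourier transform satisfies: |φ̂(g)| ≤ 4/p² if the dual type of g is (111), (12), (3) or (1²1); |φ̂(g)| ≤ 4/p if the dual type of g is (1³); and |φ̂(g)| ≤ 4 if g = 0. -/

import Mathlib

open scoped Classical
noncomputable section

/-- The twisted `GL₂`-action on binary cubic forms `f = (a,b,c,d) ↔ ax³+bx²y+cxy²+dy³`:
`(γ·f)(x,y) = det(γ)⁻¹ · f((x,y)γ)`, written out on coefficients. -/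
def matAct {R : Type*} [CommRing R] (γ : Matrix (Fin 2) (Fin 2) R) (f : Fin 4 → R) :
    Fin 4 → R :=
  let p := γ 0 0
  let q := γ 1 0
  let r := γ 0 1
  let s := γ 1 1
  fun i => Ring.inverse γ.det *
    ![f 0 * p ^ 3 + f 1 * p ^ 2 * r + f 2 * p * r ^ 2 + f 3 * r ^ 3,
      3 * f 0 * p ^ 2 * q + f 1 * (p ^ 2 * s + 2 * p * q * r) +
        f 2 * (q * r ^ 2 + 2 * p * r * s) + 3 * f 3 * r ^ 2 * s,
      3 * f 0 * p * q ^ 2 + f 1 * (2 * p * q * s + q ^ 2 * r) +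
        f 2 * (p * s ^ 2 + 2 * q * r * s) + 3 * f 3 * r * s ^ 2,
      f 0 * q ^ 3 + f 1 * q ^ 2 * s + f 2 * q * s ^ 2 + f 3 * s ^ 3] i

/-- The twisted action of the general linear group on binary cubic forms. -/
def glAct {R : Type*} [CommRing R] (γ : Matrix.GeneralLinearGroup (Fin 2) R)
    (f : Fin 4 → R) : Fin 4 → R :=
  matAct (γ : Matrix (Fin 2) (Fin 2) R) f

/-- The compatible `GL₂`-action on the dual space `V*`, with coordinates `(a*,b*,c*,d*)`
corresponding to the form `a*x³+3b*x²y+3c*xy²+d*y³`; the integral polynomial formulas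
are obtained from the twisted action through this correspondence. -/
def matActStar {R : Type*} [CommRing R] (γ : Matrix (Fin 2) (Fin 2) R) (g : Fin 4 → R) :
    Fin 4 → R :=
  let p := γ 0 0
  let q := γ 1 0
  let r := γ 0 1
  let s := γ 1 1
  fun i => Ring.inverse γ.det *
    ![g 0 * p ^ 3 + 3 * g 1 * p ^ 2 * r + 3 * g 2 * p * r ^ 2 + g 3 * r ^ 3,
      g 0 * p ^ 2 * q + g 1 * (p ^ 2 * s + 2 * p * q * r) +
        g 2 * (q * r ^ 2 + 2 * p * r * s) + g 3 * r ^ 2 * s,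
      g 0 * p * q ^ 2 + g 1 * (2 * p * q * s + q ^ 2 * r) +
        g 2 * (p * s ^ 2 + 2 * q * r * s) + g 3 * r * s ^ 2,
      g 0 * q ^ 3 + 3 * g 1 * q ^ 2 * s + 3 * g 2 * q * s ^ 2 + g 3 * s ^ 3] i

/-- The dual `GL₂`-action on `V*`. -/
def glActStar {R : Type*} [CommRing R] (γ : Matrix.GeneralLinearGroup (Fin 2) R)
    (g : Fin 4 → R) : Fin 4 → R :=
  matActStar (γ : Matrix (Fin 2) (Fin 2) R) g

/-- The duality pairing `[f,g] = d·a* − c·b* + b·c* − a·d*`. -/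
def bcfPair {R : Type*} [CommRing R] (f g : Fin 4 → R) : R :=
  f 3 * g 0 - f 2 * g 1 + f 1 * g 2 - f 0 * g 3

/-- The Fourier transform of a function on the space of binary cubic forms over `ℤ/nℤ`:
`φ̂(g) = n⁻⁴ ∑_f e^{2πi[f,g]/n} φ(f)`. -/
def bcfFourier (n : ℕ) (φ : (Fin 4 → ZMod n) → ℂ) (g : Fin 4 → ZMod n) : ℂ :=
  ((n : ℂ) ^ 4)⁻¹ * ∑' f : Fin 4 → ZMod n,
    Complex.exp (2 * Real.pi * Complex.I * (ZMod.val (bcfPair f g) : ℂ) / (n : ℂ)) * φ f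

/-- Evaluation of a binary cubic form. -/
def bcfEval {R : Type*} [CommRing R] (f : Fin 4 → R) (x y : R) : R :=
  f 0 * x ^ 3 + f 1 * x ^ 2 * y + f 2 * x * y ^ 2 + f 3 * y ^ 3

/-- Coefficients of the product `(u₁x+v₁y)(u₂x+v₂y)(u₃x+v₃y)` of three linear forms. -/
def linProd {R : Type*} [CommRing R] (u₁ v₁ u₂ v₂ u₃ v₃ : R) : Fin 4 → R :=
  ![u₁ * u₂ * u₃,
    u₁ * u₂ * v₃ + u₁ * v₂ * u₃ + v₁ * u₂ * u₃,
    u₁ * v₂ * v₃ + v₁ * u₂ * v₃ + v₁ * v₂ * u₃,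
    v₁ * v₂ * v₃]

/-- Coefficients of the product `(ux+vy)(Ax²+Bxy+Cy²)`. -/
def linQuadProd {R : Type*} [CommRing R] (u v A B C : R) : Fin 4 → R :=
  ![u * A, u * B + v * A, u * C + v * B, v * C]

/-- The six splitting types of a binary cubic form over `𝔽_p`. -/
inductive FpType : Type
  | t111 | t12 | t3 | t121 | t13 | t0

/-- `HasFpType f τ` : the binary cubic form `f` has splitting type `τ`: it factors into
three pairwise non-proportional linear forms, a linear form times an irreducible
quadratic form, an irreducible cubic form (no nontrivial zero), `ℓ²m` with `ℓ,m`
non-proportional linear forms, `ℓ³` (up to a scalar), or is zero. -/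
def HasFpType {R : Type*} [CommRing R] (f : Fin 4 → R) : FpType → Prop
  | FpType.t111 => ∃ u₁ v₁ u₂ v₂ u₃ v₃ : R,
      u₁ * v₂ - u₂ * v₁ ≠ 0 ∧ u₁ * v₃ - u₃ * v₁ ≠ 0 ∧ u₂ * v₃ - u₃ * v₂ ≠ 0 ∧
      f = linProd u₁ v₁ u₂ v₂ u₃ v₃
  | FpType.t12 => ∃ u v A B C : R, ¬(u = 0 ∧ v = 0) ∧
      (∀ x y : R, ¬(x = 0 ∧ y = 0) → A * x ^ 2 + B * x * y + C * y ^ 2 ≠ 0) ∧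
      f = linQuadProd u v A B C
  | FpType.t3 => ∀ x y : R, ¬(x = 0 ∧ y = 0) → bcfEval f x y ≠ 0
  | FpType.t121 => ∃ u₁ v₁ u₂ v₂ : R, u₁ * v₂ - u₂ * v₁ ≠ 0 ∧
      f = linProd u₁ v₁ u₁ v₁ u₂ v₂
  | FpType.t13 => ∃ u v c : R, c ≠ 0 ∧ ¬(u = 0 ∧ v = 0) ∧
      f = fun i => c * linProd u v u v u v i
  | FpType.t0 => f = 0

/-- The dual type of `g ∈ V*(𝔽_p)`: the splitting type of the associated form
`a*x³+3b*x²y+3c*xy²+d*y³`. -/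
def HasDualFpType {R : Type*} [CommRing R] (g : Fin 4 → R) (τ : FpType) : Prop :=
  HasFpType (![g 0, 3 * g 1, 3 * g 2, g 3]) τ

section Algebra

variable {R : Type*} [CommRing R] {K : Type*} [Field K]

/-- The binary cubic form `a*x³+3b*x²y+3c*xy²+d*y³` associated with an element of `V*`. -/
def assocForm (g : Fin 4 → R) : Fin 4 → R := ![g 0, 3 * g 1, 3 * g 2, g 3]

theorem matAct_mul (M N : Matrix (Fin 2) (Fin 2) K) (f : Fin 4 → K) :
    matAct (M * N) f = matAct M (matAct N f) := by
  ext i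
  fin_cases i <;>
    simp [matAct, Matrix.mul_apply, Fin.sum_univ_two] <;> ring

theorem matAct_one (f : Fin 4 → R) : matAct 1 f = f := by
  ext i
  fin_cases i <;> simp [matAct]

theorem matActStar_mul (M N : Matrix (Fin 2) (Fin 2) K) (g : Fin 4 → K) :
    matActStar (M * N) g = matActStar M (matActStar N g) := by
  ext i
  fin_cases i <;>
    simp [matActStar, Matrix.mul_apply, Fin.sum_univ_two] <;> ring

theorem matActStar_one (g : Fin 4 → R) : matActStar 1 g = g := by
  ext i
  fin_cases i <;> simp [matActStar]

theorem assocForm_matActStar (M : Matrix (Fin 2) (Fin 2) R) (g : Fin 4 → R) :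
    assocForm (matActStar M g) = matAct M (assocForm g) := by
  ext i
  fin_cases i <;> simp [matActStar, matAct, assocForm] <;> ring

theorem assocForm_injective (h3 : (3 : K) ≠ 0) :
    Function.Injective (assocForm : (Fin 4 → K) → Fin 4 → K) := by
  intro g h e
  ext i
  have := congrFun e i
  fin_cases i <;> simpa [assocForm, h3] using this

theorem bcfPair_matAct (M : Matrix (Fin 2) (Fin 2) R) (f g : Fin 4 → R) :
    bcfPair (matAct M f) g = bcfPair f (matActStar M.adjugate g) := by
  have h : M.adjugate.det = M.det := by
    rw [Matrix.adjugate_fin_two, Matrix.det_fin_two, Matrix.det_fin_two]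
    simp [mul_comm]
  simp only [bcfPair, matAct, matActStar, h]
  simp [Matrix.adjugate_fin_two]
  ring

theorem bcfEval_matAct (M : Matrix (Fin 2) (Fin 2) K) (f : Fin 4 → K) (x y : K) :
    bcfEval (matAct M f) x y =
      M.det⁻¹ * bcfEval f (x * M 0 0 + y * M 1 0) (x * M 0 1 + y * M 1 1) := by
  simp [bcfEval, matAct]
  ring

theorem bcfEval_linProd (u₁ v₁ u₂ v₂ u₃ v₃ x y : R) :
    bcfEval (linProd u₁ v₁ u₂ v₂ u₃ v₃) x y =
      (u₁ * x + v₁ * y) * (u₂ * x + v₂ * y) * (u₃ * x + v₃ * y) := by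
  simp [bcfEval, linProd]
  ring

/-- The action of `GL₂` on the dual space as a `MulAction`. -/
@[reducible] def dualAction (K : Type*) [Field K] :
    MulAction (Matrix.GeneralLinearGroup (Fin 2) K) (Fin 4 → K) where
  smul := glActStar
  one_smul g := matActStar_one g
  mul_smul M N g := matActStar_mul M.1 N.1 g

theorem exists_eq_mul_of_linear_eq_zero {u v x y : K} (h : ¬(u = 0 ∧ v = 0))
    (e : u * x + v * y = 0) : ∃ s, x = s * v ∧ y = -(s * u) := by
  by_cases hu : u = 0
  · have hv : v ≠ 0 := fun hv => h ⟨hu, hv⟩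
    refine ⟨x / v, by field_simp, ?_⟩
    subst hu
    have : y = 0 := by simpa [hv] using e
    simp [this]
  · refine ⟨-(y / u), ?_, by field_simp⟩
    field_simp
    linear_combination e

/-- A matrix fixing a product of three pairwise non-proportional linear forms and fixing
two of its roots is the identity. -/
theorem eq_one_of_matAct_eq_of_fixes_roots (h2 : (2 : K) ≠ 0) {u₁ v₁ u₂ v₂ u₃ v₃ : K}
    (h12 : u₁ * v₂ - u₂ * v₁ ≠ 0) (h13 : u₁ * v₃ - u₃ * v₁ ≠ 0)
    (h23 : u₂ * v₃ - u₃ * v₂ ≠ 0) {A : Matrix (Fin 2) (Fin 2) K} (hA : A.det ≠ 0)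
    (hfix : matAct A (linProd u₁ v₁ u₂ v₂ u₃ v₃) = linProd u₁ v₁ u₂ v₂ u₃ v₃)
    (r₁ : u₁ * (v₁ * A 0 0 - u₁ * A 1 0) + v₁ * (v₁ * A 0 1 - u₁ * A 1 1) = 0)
    (r₂ : u₂ * (v₂ * A 0 0 - u₂ * A 1 0) + v₂ * (v₂ * A 0 1 - u₂ * A 1 1) = 0) :
    A = 1 := by
  obtain ⟨s, hs, hs'⟩ := exists_eq_mul_of_linear_eq_zero
    (by rintro ⟨rfl, rfl⟩; simp at h12) r₁
  obtain ⟨t, ht, ht'⟩ := exists_eq_mul_of_linear_eq_zero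
    (by rintro ⟨rfl, rfl⟩; simp at h12) r₂
  have hdet : A.det = s * t := by
    apply mul_left_cancel₀ h12
    rw [Matrix.det_fin_two]
    linear_combination (v₂ * A 0 1 - u₂ * A 1 1) * hs - (v₂ * A 0 0 - u₂ * A 1 0) * hs' +
      s * v₁ * ht' + s * u₁ * ht
  have hst : s * t ≠ 0 := hdet ▸ hA
  have key (x y : K) : bcfEval (linProd u₁ v₁ u₂ v₂ u₃ v₃)
      (x * A 0 0 + y * A 1 0) (x * A 0 1 + y * A 1 1) =
      s * t * bcfEval (linProd u₁ v₁ u₂ v₂ u₃ v₃) x y := by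
    conv_rhs => rw [← hfix, bcfEval_matAct, hdet, mul_inv_cancel_left₀ hst]
  have hc : s * t * (u₁ * v₂ - u₂ * v₁) ^ 2 ≠ 0 := mul_ne_zero hst (pow_ne_zero 2 h12)
  have e (ε : K) : ε * (s * (u₃ * v₁ - v₃ * u₁) + ε * t * (u₃ * v₂ - v₃ * u₂)) =
      ε * ((u₃ * v₁ - v₃ * u₁) + ε * (u₃ * v₂ - v₃ * u₂)) := by
    have k := key (v₁ + ε * v₂) (-u₁ - ε * u₂)
    have e₁ : (v₁ + ε * v₂) * A 0 0 + (-u₁ - ε * u₂) * A 1 0 = s * v₁ + ε * (t * v₂) := by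
      linear_combination hs + ε * ht
    have e₂ : (v₁ + ε * v₂) * A 0 1 + (-u₁ - ε * u₂) * A 1 1 =
        -(s * u₁) - ε * (t * u₂) := by
      linear_combination hs' + ε * ht'
    rw [e₁, e₂, bcfEval_linProd, bcfEval_linProd] at k
    apply mul_left_cancel₀ hc
    linear_combination -k
  have e₁ := e 1
  have e₂ := e (-1)
  have s1 : s = 1 := by
    apply mul_left_cancel₀ (mul_ne_zero h2 h13)
    linear_combination e₂ - e₁
  have t1 : t = 1 := by
    apply mul_left_cancel₀ (mul_ne_zero h2 h23)
    linear_combination -e₂ - e₁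
  subst s1 t1
  ext i j
  apply mul_left_cancel₀ h12
  fin_cases i <;> fin_cases j <;> simp [-mul_eq_zero]
  · linear_combination u₁ * ht - u₂ * hs
  · linear_combination u₁ * ht' - u₂ * hs'
  · linear_combination v₁ * ht - v₂ * hs
  · linear_combination v₁ * ht' - v₂ * hs'

theorem cross_eq_zero_of_linear_eq_zero {u v x y x' y' : K} (h : ¬(u = 0 ∧ v = 0))
    (e : u * x + v * y = 0) (e' : u * x' + v * y' = 0) : x * y' - x' * y = 0 := by
  obtain ⟨s, rfl, rfl⟩ := exists_eq_mul_of_linear_eq_zero h e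
  obtain ⟨t, rfl, rfl⟩ := exists_eq_mul_of_linear_eq_zero h e'
  ring

/-- The product of three linear forms with coefficients indexed by `Fin 3`. -/
def linProdFin (u v : Fin 3 → R) : Fin 4 → R := linProd (u 0) (v 0) (u 1) (v 1) (u 2) (v 2)

theorem exists_root_image {u v : Fin 3 → K} {M : Matrix (Fin 2) (Fin 2) K} (hM : M.det ≠ 0)
    (hfix : matAct M (linProdFin u v) = linProdFin u v) (k : Fin 3) :
    ∃ i, u i * (v k * M 0 0 - u k * M 1 0) + v i * (v k * M 0 1 - u k * M 1 1) = 0 := by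
  have h0 : bcfEval (linProdFin u v) (v k) (-u k) = 0 := by
    rw [linProdFin, bcfEval_linProd]
    fin_cases k <;> simp <;> ring_nf <;> simp
  rw [← hfix, bcfEval_matAct, linProdFin, bcfEval_linProd] at h0
  simp only [mul_eq_zero, inv_eq_zero, hM, false_or] at h0
  rcases h0 with (h | h) | h
  · exact ⟨0, by linear_combination h⟩
  · exact ⟨1, by linear_combination h⟩
  · exact ⟨2, by linear_combination h⟩

/-- An element of the stabilizer of a product of three pairwise non-proportional linear forms
is determined by its effect on two of the roots. -/
theorem eq_of_matAct_eq_of_root_images (h2 : (2 : K) ≠ 0) {u v : Fin 3 → K}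
    (huv : ∀ i j, i ≠ j → u i * v j - u j * v i ≠ 0)
    {M N : Matrix.GeneralLinearGroup (Fin 2) K}
    (hM : matAct M.1 (linProdFin u v) = linProdFin u v)
    (hN : matAct N.1 (linProdFin u v) = linProdFin u v) (i : Fin 2 → Fin 3)
    (iM : ∀ k : Fin 2, u (i k) * (v k.castSucc * M.1 0 0 - u k.castSucc * M.1 1 0) +
      v (i k) * (v k.castSucc * M.1 0 1 - u k.castSucc * M.1 1 1) = 0)
    (iN : ∀ k : Fin 2, u (i k) * (v k.castSucc * N.1 0 0 - u k.castSucc * N.1 1 0) +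
      v (i k) * (v k.castSucc * N.1 0 1 - u k.castSucc * N.1 1 1) = 0) : M = N := by
  have hne (k : Fin 3) : ¬(u k = 0 ∧ v k = 0) := by
    rintro ⟨hu, hv⟩
    apply huv k (k + 1) (by fin_cases k <;> decide)
    simp [hu, hv]
  have hAN : (M * N⁻¹).1 * N.1 = M.1 := by rw [← Units.val_mul, inv_mul_cancel_right]
  have hA : matAct (M * N⁻¹).1 (linProdFin u v) = linProdFin u v := by
    conv_lhs => rw [← hN, ← matAct_mul, hAN, hM]
  have hdetN : N.1.det ≠ 0 := N.isUnit.map Matrix.detMonoidHom |>.ne_zero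
  have hdetA : (M * N⁻¹).1.det ≠ 0 := (M * N⁻¹).isUnit.map Matrix.detMonoidHom |>.ne_zero
  have root (k : Fin 2) : u k.castSucc *
        (v k.castSucc * (M * N⁻¹).1 0 0 - u k.castSucc * (M * N⁻¹).1 1 0) +
      v k.castSucc *
        (v k.castSucc * (M * N⁻¹).1 0 1 - u k.castSucc * (M * N⁻¹).1 1 1) = 0 := by
    have c := cross_eq_zero_of_linear_eq_zero (hne (i k)) (iM k) (iN k)
    rw [← hAN] at c
    simp only [Matrix.mul_apply, Fin.sum_univ_two] at c
    apply mul_left_cancel₀ hdetN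
    rw [Matrix.det_fin_two]
    linear_combination -c
  have := eq_one_of_matAct_eq_of_fixes_roots h2 (huv 0 1 (by decide)) (huv 0 2 (by decide))
    (huv 1 2 (by decide)) hdetA hA (root 0) (root 1)
  exact mul_inv_eq_one.mp (Units.ext this)

theorem matAct_map {F : Type*} [Field F] [Algebra F K] (M : Matrix (Fin 2) (Fin 2) F)
    (f : Fin 4 → F) :
    matAct (M.map (algebraMap F K)) (fun i => algebraMap F K (f i)) =
      fun i => algebraMap F K (matAct M f i) := by
  ext i
  fin_cases i <;>
    simp [matAct, Matrix.det_fin_two, map_ofNat (algebraMap F K)]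

theorem matAct_map_eq_of_matActStar_eq {F : Type*} [Field F] [Algebra F K]
    {g : Fin 4 → F} {f : Fin 4 → K} (hg : (fun i => algebraMap F K (assocForm g i)) = f)
    {M : Matrix (Fin 2) (Fin 2) F} (hM : matActStar M g = g) :
    matAct (M.map (algebraMap F K)) f = f := by
  rw [← hg, matAct_map, ← assocForm_matActStar, hM]

theorem card_fixing_le {F : Type*} [Field F] [Finite F] [Algebra F K] (h2 : (2 : K) ≠ 0)
    {g : Fin 4 → F} {u v : Fin 3 → K} (huv : ∀ i j, i ≠ j → u i * v j - u j * v i ≠ 0)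
    (hg : (fun i => algebraMap F K (assocForm g i)) = linProdFin u v) :
    Nat.card {γ : Matrix.GeneralLinearGroup (Fin 2) F // matActStar γ.1 g = g} ≤ 9 := by
  let ι := Matrix.GeneralLinearGroup.map (n := Fin 2) (algebraMap F K)
  have hfix (γ : {γ : Matrix.GeneralLinearGroup (Fin 2) F // matActStar γ.1 g = g}) :
      matAct (ι γ.1).1 (linProdFin u v) = linProdFin u v :=
    matAct_map_eq_of_matActStar_eq hg γ.2
  have hdet (γ : Matrix.GeneralLinearGroup (Fin 2) F) : (ι γ).1.det ≠ 0 :=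
    (ι γ).isUnit.map Matrix.detMonoidHom |>.ne_zero
  choose i hi using fun (γ : {γ : Matrix.GeneralLinearGroup (Fin 2) F // matActStar γ.1 g = g})
    (k : Fin 2) => exists_root_image (hdet γ.1) (hfix γ) k.castSucc
  have hinj : Function.Injective i := by
    intro γ δ e
    have h := eq_of_matAct_eq_of_root_images h2 huv (hfix γ) (hfix δ) (i γ) (hi γ)
      (by rw [e]; exact hi δ)
    apply Subtype.ext
    apply Units.ext
    ext a b
    exact (algebraMap F K).injective
      (congrArg (fun x : Matrix.GeneralLinearGroup (Fin 2) K => x.1 a b) h)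
  simpa using Nat.card_le_card_of_injective i hinj

end Algebra

section Factorization

variable {F : Type*} [Field F] (K : Type*) [Field K] [Algebra F K]

/-- `f` factors over `K` into three pairwise non-proportional linear forms. -/
def SplitsDistinctly (f : Fin 4 → F) : Prop :=
  ∃ u v : Fin 3 → K, (∀ i j, i ≠ j → u i * v j - u j * v i ≠ 0) ∧
    (fun i => algebraMap F K (f i)) = linProdFin u v

variable {K}

theorem splitsDistinctly_of_factors {f : Fin 4 → F} {u₁ v₁ u₂ v₂ u₃ v₃ : K}
    (h12 : u₁ * v₂ - u₂ * v₁ ≠ 0) (h13 : u₁ * v₃ - u₃ * v₁ ≠ 0)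
    (h23 : u₂ * v₃ - u₃ * v₂ ≠ 0)
    (hf : (fun i => algebraMap F K (f i)) = linProd u₁ v₁ u₂ v₂ u₃ v₃) :
    SplitsDistinctly K f := by
  refine ⟨![u₁, u₂, u₃], ![v₁, v₂, v₃], ?_, by simpa [linProdFin] using hf⟩
  have h21 := neg_ne_zero.mpr h12
  have h31 := neg_ne_zero.mpr h13
  have h32 := neg_ne_zero.mpr h23
  rw [neg_sub] at h21 h31 h32
  intro i j hij
  fin_cases i <;> fin_cases j <;> first | exact absurd rfl hij | assumption

theorem HasFpType.splitsDistinctly_of_t111 {f : Fin 4 → F} (h : HasFpType f FpType.t111) :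
    SplitsDistinctly F f := by
  obtain ⟨u₁, v₁, u₂, v₂, u₃, v₃, h12, h13, h23, rfl⟩ := h
  exact splitsDistinctly_of_factors h12 h13 h23 (by simp)

theorem HasFpType.splitsDistinctly_of_t12 [IsAlgClosed K] (h2 : (2 : F) ≠ 0)
    {f : Fin 4 → F} (h : HasFpType f FpType.t12) : SplitsDistinctly K f := by
  obtain ⟨u, v, A, B, C, huv, hq, rfl⟩ := h
  have hA : A ≠ 0 := by simpa using hq 1 0 (by simp)
  let T := algebraMap F K
  obtain ⟨δ, hδ⟩ := IsAlgClosed.exists_eq_mul_self (T (B ^ 2 - 4 * A * C))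
  have hTA : T A ≠ 0 := by simpa [T] using hA
  have hT2 : (2 : K) ≠ 0 := by simpa [T, map_ofNat] using (map_ne_zero T).mpr h2
  have hδ0 : δ ≠ 0 := by
    rintro rfl
    have hd : B ^ 2 - 4 * A * C = 0 :=
      (map_eq_zero T).mp (by rw [hδ, mul_zero])
    apply hq (-B) (2 * A) (by simp [hA, h2])
    linear_combination -A * hd
  have hδ' : δ * δ = T B ^ 2 - 4 * T A * T C := by
    rw [← hδ]; simp [T, map_ofNat]
  have hlin : T (A * v ^ 2 - B * u * v + C * u ^ 2) ≠ 0 := by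
    rw [map_ne_zero]
    have := hq v (-u) (by simpa [and_comm] using huv)
    convert! this using 1
    ring
  have hprod (ε : K) (hε : ε ^ 2 = 1) : T u * ((T B - ε * δ) / (2 * T A)) - 1 * T v ≠ 0 := by
    intro e
    apply hlin
    field_simp at e
    simp only [map_sub, map_add, map_mul, map_pow]
    apply mul_left_cancel₀ (mul_ne_zero (mul_ne_zero hT2 hT2) hTA)
    have e' : (T u * (T B - ε * δ) - 2 * T A * T v) = 0 := by linear_combination e
    linear_combination (T u * (-T B - ε * δ) + 2 * T A * T v) * e' * (-1 : K) +
      T u ^ 2 * δ ^ 2 * hε + T u ^ 2 * hδ'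
  refine splitsDistinctly_of_factors (u₁ := T A * T u) (v₁ := T A * T v)
    (u₂ := 1) (v₂ := (T B - 1 * δ) / (2 * T A)) (u₃ := 1)
    (v₃ := (T B - (-1) * δ) / (2 * T A)) ?_ ?_ ?_ ?_
  · have := mul_ne_zero hTA (hprod 1 (by simp))
    convert! this using 1
    ring
  · have := mul_ne_zero hTA (hprod (-1) (by simp))
    convert! this using 1
    ring
  · have := div_ne_zero hδ0 hTA
    convert! this using 1
    field_simp
    ring
  · have hT4 : (4 : K) ≠ 0 := by
      rw [show (4 : K) = 2 * 2 by norm_num]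
      exact mul_ne_zero hT2 hT2
    have hC : T C = T A * ((T B - 1 * δ) / (2 * T A)) * ((T B - (-1) * δ) / (2 * T A)) := by
      have : T C = (T B ^ 2 - δ * δ) / (4 * T A) := by
        rw [hδ']; field_simp; ring
      rw [this]; field_simp; ring
    have hB : T B = T A * ((T B - 1 * δ) / (2 * T A) + (T B - (-1) * δ) / (2 * T A)) := by
      field_simp; ring
    ext i
    fin_cases i <;> simp [linProd, linQuadProd]
    · ring
    · linear_combination T u * hB
    · linear_combination T u * hC + T v * hB
    · linear_combination T v * hC

theorem HasFpType.splitsDistinctly_of_t3 [PerfectField F] [IsAlgClosed K]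
    {f : Fin 4 → F} (h : HasFpType f FpType.t3) : SplitsDistinctly K f := by
  let P : Cubic F := ⟨f 0, f 1, f 2, f 3⟩
  have ha : P.a ≠ 0 := by simpa [bcfEval] using h 1 0 (by simp)
  have hdeg : P.toPoly.natDegree = 3 := Cubic.natDegree_of_a_ne_zero ha
  have hroots : P.toPoly.roots = 0 := by
    rw [Multiset.eq_zero_iff_forall_notMem]
    intro x hx
    apply h x 1 (by simp)
    have := (Polynomial.mem_roots'.mp hx).2
    simpa [Cubic.toPoly, bcfEval, P] using this
  have hirr : Irreducible P.toPoly :=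
    (Polynomial.irreducible_iff_roots_eq_zero_of_degree_le_three (by omega) (by omega)).mpr hroots
  have hsep := (PerfectField.separable_of_irreducible hirr).map (f := algebraMap F K)
  obtain ⟨x, y, z, hr⟩ := (Cubic.splits_iff_roots_eq_three (φ := algebraMap F K) ha).mp
    (IsAlgClosed.splits _)
  have hnd := Polynomial.nodup_roots hsep
  rw [← Cubic.map_toPoly] at hnd
  change (Cubic.map (algebraMap F K) P).roots.Nodup at hnd
  rw [hr] at hnd
  simp at hnd
  obtain ⟨⟨hxy, hxz⟩, hyz⟩ := hnd
  have hTa : algebraMap F K P.a ≠ 0 := by simpa using ha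
  refine splitsDistinctly_of_factors (u₁ := algebraMap F K P.a)
    (v₁ := -(algebraMap F K P.a * x)) (u₂ := 1) (v₂ := -y) (u₃ := 1) (v₃ := -z) ?_ ?_ ?_ ?_
  · have := mul_ne_zero hTa (sub_ne_zero.mpr hxy)
    convert! this using 1
    ring
  · have := mul_ne_zero hTa (sub_ne_zero.mpr hxz)
    convert! this using 1
    ring
  · have := sub_ne_zero.mpr hyz
    convert! this using 1
    ring
  · have hb := Cubic.b_eq_three_roots ha hr
    have hc := Cubic.c_eq_three_roots ha hr
    have hd := Cubic.d_eq_three_roots ha hr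
    ext i
    fin_cases i <;> simp [linProd]
    · rfl
    · refine hb.trans ?_
      ring
    · refine hc.trans ?_
      ring
    · refine hd.trans ?_
      ring

end Factorization

section Fourier

variable {p : ℕ} [Fact p.Prime]

/-- The unnormalized Fourier transform on the space of binary cubic forms. -/
def bcfSum (φ : (Fin 4 → ZMod p) → ℂ) (g : Fin 4 → ZMod p) : ℂ :=
  ∑ f, ZMod.stdAddChar (bcfPair f g) * φ f

theorem bcfFourier_eq (φ : (Fin 4 → ZMod p) → ℂ) (g : Fin 4 → ZMod p) :
    bcfFourier p φ g = ((p : ℂ) ^ 4)⁻¹ * bcfSum φ g := by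
  simp only [bcfFourier, bcfSum, tsum_fintype, ZMod.stdAddChar_apply, ZMod.toCircle_apply]

theorem sum_stdAddChar_bcfPair (f : Fin 4 → ZMod p) :
    ∑ g, (ZMod.stdAddChar (bcfPair f g) : ℂ) = if f = 0 then (p : ℂ) ^ 4 else 0 := by
  split_ifs with h
  · subst h
    simp [bcfPair]
  · let L : (Fin 4 → ZMod p) →+ ZMod p :=
      { toFun := bcfPair f
        map_zero' := by simp [bcfPair]
        map_add' := fun a b => by simp [bcfPair]; ring }
    refine AddChar.sum_eq_zero_of_ne_one
      (ψ := (ZMod.stdAddChar (N := p)).compAddMonoidHom L) fun h1 => h ?_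
    have key (g : Fin 4 → ZMod p) : bcfPair f g = 0 := by
      apply ZMod.injective_stdAddChar (N := p)
      rw [AddChar.map_zero_eq_one]
      exact DFunLike.congr_fun h1 g
    ext i
    have h0 := key (Pi.single 0 1)
    have h1 := key (Pi.single 1 1)
    have h2 := key (Pi.single 2 1)
    have h3 := key (Pi.single 3 1)
    simp [bcfPair] at h0 h1 h2 h3
    fin_cases i <;> assumption

theorem sum_norm_sq_bcfSum (φ : (Fin 4 → ZMod p) → ℂ) :
    ∑ g, ‖bcfSum φ g‖ ^ 2 = (p : ℝ) ^ 4 * ∑ f, ‖φ f‖ ^ 2 := by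
  apply Complex.ofReal_injective
  push_cast
  simp_rw [← Complex.mul_conj']
  have expand (g : Fin 4 → ZMod p) : bcfSum φ g * (starRingEnd ℂ) (bcfSum φ g) =
      ∑ f, ∑ f', φ f * (starRingEnd ℂ) (φ f') * ZMod.stdAddChar (bcfPair (f - f') g) := by
    rw [bcfSum, map_sum, Finset.sum_mul_sum]
    refine Finset.sum_congr rfl fun f _ => Finset.sum_congr rfl fun f' _ => ?_
    have : bcfPair (f - f') g = bcfPair f g + -bcfPair f' g := by
      simp [bcfPair]; ring
    rw [this, AddChar.map_add_eq_mul, AddChar.map_neg_eq_conj, map_mul]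
    ring
  simp_rw [expand]
  rw [Finset.sum_comm, Finset.mul_sum]
  refine Finset.sum_congr rfl fun f _ => ?_
  rw [Finset.sum_comm]
  simp_rw [← Finset.mul_sum, sum_stdAddChar_bcfPair, sub_eq_zero]
  simp
  ring

theorem matAct_bijective {M : Matrix (Fin 2) (Fin 2) (ZMod p)} (hM : M.det ≠ 0) :
    Function.Bijective (matAct M) := by
  rw [← Finite.injective_iff_bijective]
  apply Function.LeftInverse.injective (g := matAct M⁻¹)
  intro f
  rw [← matAct_mul, Matrix.nonsing_inv_mul _ hM.isUnit, matAct_one]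

/-- Invariance of a function on binary cubic forms under the twisted `GL₂`-action. -/
def GLInvariant (φ : (Fin 4 → ZMod p) → ℂ) : Prop :=
  ∀ (γ : Matrix.GeneralLinearGroup (Fin 2) (ZMod p)) (f : Fin 4 → ZMod p), φ (glAct γ f) = φ f

variable {φ : (Fin 4 → ZMod p) → ℂ}

theorem GLInvariant.bcfSum_eq_sum_matAct (hinv : GLInvariant φ)
    {M : Matrix (Fin 2) (Fin 2) (ZMod p)} (hM : M.det ≠ 0) (g : Fin 4 → ZMod p) :
    bcfSum φ g = ∑ f, ZMod.stdAddChar (bcfPair (matAct M f) g) * φ f := by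
  rw [bcfSum, ← (matAct_bijective hM).sum_comp]
  refine Finset.sum_congr rfl fun f _ => ?_
  rw [show φ (matAct M f) = φ f from
    hinv (Matrix.GeneralLinearGroup.mkOfDetNeZero M hM) f]

theorem GLInvariant.bcfSum_matActStar (hinv : GLInvariant φ)
    {M : Matrix (Fin 2) (Fin 2) (ZMod p)} (hM : M.det ≠ 0) (g : Fin 4 → ZMod p) :
    bcfSum φ (matActStar M g) = bcfSum φ g := by
  have hadj : M.adjugate.adjugate = M := by simp [Matrix.adjugate_adjugate]
  have hdet : M.adjugate.det ≠ 0 := by simpa [Matrix.det_adjugate] using hM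
  rw [hinv.bcfSum_eq_sum_matAct hdet g, bcfSum]
  simp_rw [bcfPair_matAct, hadj]

/-- Plancherel bound for the Fourier transform at a point with small stabilizer. -/
theorem GLInvariant.norm_sq_bcfSum_mul_le (hinv : GLInvariant φ) (hbd : ∀ f, ‖φ f‖ ≤ 1)
    {g : Fin 4 → ZMod p}
    (hg : Nat.card {γ : Matrix.GeneralLinearGroup (Fin 2) (ZMod p) // matActStar γ.1 g = g} ≤ 9) :
    ‖bcfSum φ g‖ ^ 2 * (((p : ℝ) ^ 2 - 1) * ((p : ℝ) ^ 2 - p)) ≤ 9 * (p : ℝ) ^ 8 := by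
  let := dualAction (ZMod p)
  let G := Matrix.GeneralLinearGroup (Fin 2) (ZMod p)
  have hp1 : 1 ≤ p := (Fact.out : p.Prime).one_le
  have hcard : (Nat.card G : ℝ) = ((p : ℝ) ^ 2 - 1) * ((p : ℝ) ^ 2 - p) := by
    rw [Matrix.card_GL_field, Fin.prod_univ_two, ZMod.card]
    simp only [Fin.val_zero, Fin.val_one, pow_zero, pow_one]
    rw [Nat.cast_mul, Nat.cast_sub (Nat.one_le_pow _ _ hp1),
      Nat.cast_sub (Nat.le_self_pow two_ne_zero p)]
    push_cast
    ring
  have horb : Nat.card G ≤ 9 * (MulAction.orbit G g).ncard := by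
    rw [← Subgroup.card_mul_index (MulAction.stabilizer G g), MulAction.index_stabilizer]
    exact Nat.mul_le_mul_right _ hg
  have hconst : ∀ h ∈ (MulAction.orbit G g).toFinset, ‖bcfSum φ h‖ ^ 2 = ‖bcfSum φ g‖ ^ 2 := by
    intro h hh
    obtain ⟨γ, rfl⟩ := Set.mem_toFinset.mp hh
    rw [show bcfSum φ (γ • g) = bcfSum φ g from
      hinv.bcfSum_matActStar (γ.isUnit.map Matrix.detMonoidHom |>.ne_zero) g]
  have hsum : ((MulAction.orbit G g).ncard : ℝ) * ‖bcfSum φ g‖ ^ 2 ≤ (p : ℝ) ^ 8 := by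
    calc ((MulAction.orbit G g).ncard : ℝ) * ‖bcfSum φ g‖ ^ 2
        = ∑ h ∈ (MulAction.orbit G g).toFinset, ‖bcfSum φ h‖ ^ 2 := by
          rw [Finset.sum_congr rfl hconst, Finset.sum_const, nsmul_eq_mul,
            Set.ncard_eq_toFinset_card']
      _ ≤ ∑ h, ‖bcfSum φ h‖ ^ 2 :=
          Finset.sum_le_univ_sum_of_nonneg fun _ => by positivity
      _ = (p : ℝ) ^ 4 * ∑ f, ‖φ f‖ ^ 2 := sum_norm_sq_bcfSum φ
      _ ≤ (p : ℝ) ^ 4 * ∑ _f : Fin 4 → ZMod p, 1 := by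
          gcongr with f
          exact pow_le_one₀ (norm_nonneg _) (hbd f)
      _ = (p : ℝ) ^ 8 := by
          simp [ZMod.card]
          ring
  have horb' : (Nat.card G : ℝ) ≤ 9 * (MulAction.orbit G g).ncard := by exact_mod_cast horb
  rw [← hcard]
  nlinarith [mul_le_mul_of_nonneg_right horb' (sq_nonneg ‖bcfSum φ g‖)]

/-- Averaging over a family of group elements bounds the Fourier transform. -/
theorem GLInvariant.card_mul_norm_bcfSum_le (hinv : GLInvariant φ) (hbd : ∀ f, ‖φ f‖ ≤ 1)
    {Ω : Type*} (s : Finset Ω) {M : Ω → Matrix (Fin 2) (Fin 2) (ZMod p)}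
    (hM : ∀ ω ∈ s, (M ω).det ≠ 0) (g : Fin 4 → ZMod p) :
    s.card * ‖bcfSum φ g‖ ≤
      ∑ f, ‖∑ ω ∈ s, (ZMod.stdAddChar (bcfPair (matAct (M ω) f) g) : ℂ)‖ := by
  have : (s.card : ℂ) * bcfSum φ g =
      ∑ f, (∑ ω ∈ s, (ZMod.stdAddChar (bcfPair (matAct (M ω) f) g) : ℂ)) * φ f := by
    simp_rw [Finset.sum_mul]
    rw [Finset.sum_comm, ← nsmul_eq_mul, ← Finset.sum_const]
    exact Finset.sum_congr rfl fun ω hω => hinv.bcfSum_eq_sum_matAct (hM ω hω) g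
  calc s.card * ‖bcfSum φ g‖ = ‖(s.card : ℂ) * bcfSum φ g‖ := by simp
    _ ≤ _ := by
      rw [this]
      refine norm_sum_le_of_le _ fun f _ => ?_
      rw [norm_mul]
      exact mul_le_of_le_one_right (norm_nonneg _) (hbd f)

/-- The absolute value of a sum of a non-trivial character over the multiples of `a` by
nonzero scalars. -/
def punctured (a : ZMod p) : ℝ := if a = 0 then p - 1 else 1

theorem norm_sum_stdAddChar_erase_zero (a : ZMod p) :
    ‖∑ t ∈ Finset.univ.erase (0 : ZMod p), (ZMod.stdAddChar (t * a) : ℂ)‖ = punctured a := by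
  have hp1 : (1 : ℝ) ≤ p := by exact_mod_cast (Fact.out : p.Prime).one_le
  rw [Finset.sum_erase_eq_sub (Finset.mem_univ _),
    AddChar.sum_mulShift a (ZMod.isPrimitive_stdAddChar p), punctured]
  split_ifs
  · rw [ZMod.card, zero_mul, AddChar.map_zero_eq_one, show ((p : ℂ) - 1) = ((p - 1 : ℝ) : ℂ) by
      push_cast; rfl, Complex.norm_real, Real.norm_of_nonneg (by linarith)]
  · simp

theorem sum_punctured : ∑ a : ZMod p, punctured a = 2 * ((p : ℝ) - 1) := by
  have h : ∀ a : ZMod p, punctured a = 1 + if a = 0 then (p : ℝ) - 2 else 0 := by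
    intro a
    unfold punctured
    split_ifs <;> ring
  simp_rw [h, Finset.sum_add_distrib]
  simp [ZMod.card]
  ring

theorem card_erase_zero : ((Finset.univ.erase (0 : ZMod p)).card : ℝ) = (p : ℝ) - 1 := by
  rw [Finset.card_erase_of_mem (Finset.mem_univ _), Finset.card_univ, ZMod.card,
    Nat.cast_sub (Fact.out : p.Prime).one_le, Nat.cast_one]

theorem punctured_mul {k : ZMod p} (hk : k ≠ 0) (a : ZMod p) :
    punctured (a * k) = punctured a := by
  simp [punctured, hk]

theorem GLInvariant.norm_bcfSum_le_of_cube (hinv : GLInvariant φ) (hbd : ∀ f, ‖φ f‖ ≤ 1)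
    {k : ZMod p} (hk : k ≠ 0) : ‖bcfSum φ ![k, 0, 0, 0]‖ ≤ 2 * (p : ℝ) ^ 3 := by
  have hp1 : (1 : ℝ) < p := by exact_mod_cast (Fact.out : p.Prime).one_lt
  have h := hinv.card_mul_norm_bcfSum_le hbd (Finset.univ.erase (0 : ZMod p))
    (M := fun t => !![t⁻¹, 0; 0, 1]) (fun t ht => by simpa using ht) ![k, 0, 0, 0]
  have hterm (f : Fin 4 → ZMod p) : ‖∑ t ∈ Finset.univ.erase (0 : ZMod p),
      (ZMod.stdAddChar (bcfPair (matAct !![t⁻¹, 0; 0, 1] f) ![k, 0, 0, 0]) : ℂ)‖ =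
      ∏ i, (![fun _ => 1, fun _ => 1, fun _ => 1, punctured] : Fin 4 → ZMod p → ℝ) i (f i) := by
    simp only [Fin.prod_univ_four]
    trans punctured (f 3)
    · rw [← punctured_mul hk, ← norm_sum_stdAddChar_erase_zero]
      simp [bcfPair, matAct, mul_assoc]
    · simp
  simp_rw [hterm] at h
  rw [← Fintype.prod_sum, card_erase_zero] at h
  simp [Fin.prod_univ_four, sum_punctured] at h
  apply le_of_mul_le_mul_left _ (sub_pos.mpr hp1)
  linarith

theorem GLInvariant.norm_bcfSum_le_of_double_root (hinv : GLInvariant φ)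
    (hbd : ∀ f, ‖φ f‖ ≤ 1) {k : ZMod p} (h3 : (3 : ZMod p) ≠ 0) (hk : k ≠ 0) :
    ‖bcfSum φ ![0, k, 0, 0]‖ ≤ 2 * (p : ℝ) ^ 2 := by
  have hp1 : (1 : ℝ) < p := by exact_mod_cast (Fact.out : p.Prime).one_lt
  have hp0 : (0 : ℝ) < p := by linarith
  have h := hinv.card_mul_norm_bcfSum_le hbd
    (Finset.univ.erase (0 : ZMod p) ×ˢ (Finset.univ : Finset (ZMod p)))
    (M := fun ω => !![1, ω.2; 0, ω.1]) (fun ω hω => by simpa using hω) ![0, k, 0, 0]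
  have hterm (f : Fin 4 → ZMod p) :
      ‖∑ ω ∈ Finset.univ.erase (0 : ZMod p) ×ˢ (Finset.univ : Finset (ZMod p)),
      (ZMod.stdAddChar (bcfPair (matAct !![1, ω.2; 0, ω.1] f) ![0, k, 0, 0]) : ℂ)‖ =
      ∏ i, (![fun _ => 1, fun _ => 1, punctured, fun d => if d = 0 then (p : ℝ) else 0] :
        Fin 4 → ZMod p → ℝ) i (f i) := by
    have e : ∀ t ∈ Finset.univ.erase (0 : ZMod p),
        ∑ b : ZMod p, (ZMod.stdAddChar (bcfPair (matAct !![1, b; 0, t] f) ![0, k, 0, 0]) : ℂ) =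
        ZMod.stdAddChar (t * (f 2 * -k)) * if f 3 = 0 then (p : ℂ) else 0 := by
      intro t ht
      have ht0 : t ≠ 0 := Finset.ne_of_mem_erase ht
      have e' (b : ZMod p) : bcfPair (matAct !![1, b; 0, t] f) ![0, k, 0, 0] =
          t * (f 2 * -k) + b * (-3 * k * t * f 3) := by
        simp [bcfPair, matAct]
        field_simp
        ring
      simp_rw [e', AddChar.map_add_eq_mul, ← Finset.mul_sum]
      rw [AddChar.sum_mulShift _ (ZMod.isPrimitive_stdAddChar p)]
      simp [h3, hk, ht0, ZMod.card]
    rw [Finset.sum_product, Finset.sum_congr rfl e, ← Finset.sum_mul, norm_mul,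
      norm_sum_stdAddChar_erase_zero, punctured_mul (neg_ne_zero.mpr hk)]
    simp only [Fin.prod_univ_four]
    split_ifs with h0 <;> simp [h0]
  simp_rw [hterm] at h
  rw [← Fintype.prod_sum, Finset.card_product, Nat.cast_mul, card_erase_zero] at h
  simp [Fin.prod_univ_four, sum_punctured, ZMod.card] at h
  apply le_of_mul_le_mul_left _ (mul_pos (sub_pos.mpr hp1) hp0)
  linarith

theorem norm_bcfSum_le (hbd : ∀ f, ‖φ f‖ ≤ 1) (g : Fin 4 → ZMod p) :
    ‖bcfSum φ g‖ ≤ (p : ℝ) ^ 4 := by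
  calc ‖bcfSum φ g‖ ≤ ∑ _f : Fin 4 → ZMod p, (1 : ℝ) := by
        refine norm_sum_le_of_le _ fun f _ => ?_
        simpa using hbd f
    _ = (p : ℝ) ^ 4 := by simp [ZMod.card]

theorem GLInvariant.norm_bcfSum_le_of_splitsDistinctly (hinv : GLInvariant φ)
    (hbd : ∀ f, ‖φ f‖ ≤ 1) {K : Type*} [Field K] [Algebra (ZMod p) K] (hp : 5 ≤ p)
    {g : Fin 4 → ZMod p} (hg : SplitsDistinctly K (assocForm g)) :
    ‖bcfSum φ g‖ ≤ 4 * (p : ℝ) ^ 2 := by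
  have h2 : (2 : K) ≠ 0 := by
    have : ((2 : ℕ) : ZMod p) ≠ 0 := by
      rw [Ne, ZMod.natCast_eq_zero_iff]
      exact fun h => by have := Nat.le_of_dvd two_pos h; omega
    simpa [map_ofNat] using (map_ne_zero (algebraMap (ZMod p) K)).mpr this
  obtain ⟨u, v, huv, he⟩ := hg
  have h := hinv.norm_sq_bcfSum_mul_le hbd (card_fixing_le h2 huv he)
  have hp' : (5 : ℝ) ≤ p := by exact_mod_cast hp
  have hlow : 9 * (p : ℝ) ^ 4 ≤ 16 * (((p : ℝ) ^ 2 - 1) * ((p : ℝ) ^ 2 - p)) := by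
    have h1 : (24 : ℝ) * p ^ 2 ≤ 25 * ((p : ℝ) ^ 2 - 1) := by nlinarith
    have h2 : (4 : ℝ) * p ^ 2 ≤ 5 * ((p : ℝ) ^ 2 - p) := by nlinarith
    nlinarith [mul_le_mul h1 h2 (by positivity) (by nlinarith)]
  have hp4 : (0 : ℝ) < 9 * (p : ℝ) ^ 4 := by positivity
  apply le_of_sq_le_sq _ (by positivity)
  apply le_of_mul_le_mul_right _ hp4
  nlinarith [mul_le_mul_of_nonneg_left hlow (sq_nonneg ‖bcfSum φ g‖)]

theorem norm_bcfFourier_le {g : Fin 4 → ZMod p} {C : ℝ} (h : ‖bcfSum φ g‖ ≤ C * (p : ℝ) ^ 4) :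
    ‖bcfFourier p φ g‖ ≤ C := by
  have hp : (0 : ℝ) < p := by exact_mod_cast (Fact.out : p.Prime).pos
  rw [bcfFourier_eq, norm_mul, norm_inv, norm_pow, Complex.norm_natCast,
    inv_mul_le_iff₀ (by positivity)]
  linarith

theorem HasDualFpType.exists_of_t13 {K : Type*} [Field K] (h3 : (3 : K) ≠ 0)
    {g : Fin 4 → K} (hg : HasDualFpType g FpType.t13) :
    ∃ (M : Matrix (Fin 2) (Fin 2) K) (k : K), M.det ≠ 0 ∧ k ≠ 0 ∧
      g = matActStar M ![k, 0, 0, 0] := by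
  obtain ⟨u, v, c, hc, huv, h⟩ := hg
  obtain ⟨r, s, hd⟩ : ∃ r s : K, u * s - r * v ≠ 0 := by
    by_cases hu : u = 0
    · exact ⟨1, 0, by simpa [hu] using huv⟩
    · exact ⟨0, 1, by simpa using hu⟩
  have hM : (!![u, r; v, s] : Matrix (Fin 2) (Fin 2) K).det ≠ 0 := by
    simpa [Matrix.det_fin_two] using hd
  have hd' : u * s - v * r ≠ 0 := by rwa [mul_comm v r]
  refine ⟨!![u, r; v, s], c * (u * s - r * v), hM, mul_ne_zero hc hd,
    assocForm_injective h3 ?_⟩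
  rw [assocForm_matActStar]
  refine h.trans ?_
  ext i
  fin_cases i <;> simp [matAct, linProd, assocForm] <;> field_simp <;> ring

theorem HasDualFpType.exists_of_t121 {K : Type*} [Field K] (h3 : (3 : K) ≠ 0)
    {g : Fin 4 → K} (hg : HasDualFpType g FpType.t121) :
    ∃ (M : Matrix (Fin 2) (Fin 2) K) (k : K), M.det ≠ 0 ∧ k ≠ 0 ∧
      g = matActStar M ![0, k, 0, 0] := by
  obtain ⟨u, v, r, s, hd, h⟩ := hg
  have hM : (!![u, r; v, s] : Matrix (Fin 2) (Fin 2) K).det ≠ 0 := by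
    simpa [Matrix.det_fin_two] using hd
  have hd' : u * s - v * r ≠ 0 := by rwa [mul_comm v r]
  have hd'' : s * u - v * r ≠ 0 := by rwa [mul_comm s u]
  refine ⟨!![u, r; v, s], (u * s - r * v) / 3, hM, div_ne_zero hd h3,
    assocForm_injective h3 ?_⟩
  rw [assocForm_matActStar]
  refine h.trans ?_
  ext i
  fin_cases i <;> simp [matAct, linProd, assocForm] <;> field_simp <;> ring

end Fourier

/-- Decay of the Fourier transform of a bounded `GL₂(𝔽_p)`-invariant function on the
space of binary cubic forms over `𝔽_p` (`p ≠ 3`), according to the dual type. -/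
theorem fourier_decay_of_invariant (p : ℕ) [Fact p.Prime] (hp3 : p ≠ 3)
    (φ : (Fin 4 → ZMod p) → ℂ)
    (hinv : ∀ (γ : Matrix.GeneralLinearGroup (Fin 2) (ZMod p)) (f : Fin 4 → ZMod p),
      φ (glAct γ f) = φ f)
    (hbd : ∀ f : Fin 4 → ZMod p, ‖φ f‖ ≤ 1) :
    ∀ (g : Fin 4 → ZMod p) (σ : FpType), HasDualFpType g σ →
      ‖bcfFourier p φ g‖ ≤
        match σ with
        | FpType.t111 => 4 / (p : ℝ) ^ 2
        | FpType.t12 => 4 / (p : ℝ) ^ 2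
        | FpType.t3 => 4 / (p : ℝ) ^ 2
        | FpType.t121 => 4 / (p : ℝ) ^ 2
        | FpType.t13 => 4 / (p : ℝ)
        | FpType.t0 => 4 := by
  intro g σ hσ
  have hpr : p.Prime := Fact.out
  have hp0 : (0 : ℝ) < p := by exact_mod_cast hpr.pos
  have trivial_bound : ‖bcfFourier p φ g‖ ≤ 1 :=
    norm_bcfFourier_le (by simpa using norm_bcfSum_le hbd g)
  obtain rfl | hp5 : p = 2 ∨ 5 ≤ p := by
    have h2 := hpr.two_le
    have h4 : p ≠ 4 := by
      rintro rfl
      exact absurd hpr (by decide)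
    omega
  · refine trivial_bound.trans ?_
    cases σ <;> norm_num
  have h3 : (3 : ZMod p) ≠ 0 := by
    have : ((3 : ℕ) : ZMod p) ≠ 0 := by
      rw [Ne, ZMod.natCast_eq_zero_iff]
      exact fun h => by have := Nat.le_of_dvd three_pos h; omega
    exact_mod_cast this
  have h2 : (2 : ZMod p) ≠ 0 := by
    have : ((2 : ℕ) : ZMod p) ≠ 0 := by
      rw [Ne, ZMod.natCast_eq_zero_iff]
      exact fun h => by have := Nat.le_of_dvd two_pos h; omega
    exact_mod_cast this
  have hφ : GLInvariant φ := hinv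
  have quadratic (h : ‖bcfSum φ g‖ ≤ 4 * (p : ℝ) ^ 2) :
      ‖bcfFourier p φ g‖ ≤ 4 / (p : ℝ) ^ 2 := by
    apply norm_bcfFourier_le
    convert h using 1
    field_simp
  cases σ
  · exact quadratic (hφ.norm_bcfSum_le_of_splitsDistinctly hbd hp5
      (HasFpType.splitsDistinctly_of_t111 hσ))
  · exact quadratic (hφ.norm_bcfSum_le_of_splitsDistinctly hbd hp5
      (K := AlgebraicClosure (ZMod p)) (HasFpType.splitsDistinctly_of_t12 h2 hσ))
  · exact quadratic (hφ.norm_bcfSum_le_of_splitsDistinctly hbd hp5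
      (K := AlgebraicClosure (ZMod p)) (HasFpType.splitsDistinctly_of_t3 hσ))
  · obtain ⟨M, k, hM, hk, rfl⟩ := HasDualFpType.exists_of_t121 h3 hσ
    apply quadratic
    rw [hφ.bcfSum_matActStar hM]
    exact (hφ.norm_bcfSum_le_of_double_root hbd h3 hk).trans (by gcongr; norm_num)
  · obtain ⟨M, k, hM, hk, rfl⟩ := HasDualFpType.exists_of_t13 h3 hσ
    apply norm_bcfFourier_le
    rw [hφ.bcfSum_matActStar hM]
    refine (hφ.norm_bcfSum_le_of_cube hbd hk).trans ?_
    rw [div_mul_eq_mul_div, le_div_iff₀ hp0, mul_assoc, ← pow_succ]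
    gcongr
    norm_num
  · exact trivial_bound.trans (by norm_num)
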